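/- arXiv:1802.06266 — 2 statements merged into one kernel-verified Lean document; each statement's English description precedes it below -/
import Mathlib

section
/- Let φ ∈ C*(𝕋) with Fourier coefficient φ̂(1) ≠ 0. Then for every integer N ≥ 1 and every multi-integer k ∈ ℤ^q, the uniform error satisfies sup_{x ∈ 𝕋^q} | exp(ik·x) − (1/((2N+1) φ̂(1))) Σ_{j=0}^{2N} exp(2πi j/(2N+1)) φ(k·x − 2π j/(2N+1)) | ≤ (4/|φ̂(1)|) E_N(1; φ). -/
open MeasureTheory Real

noncomputable section

instance fact_two_pi_pos : Fact (0 < 2 * π) := ⟨by positivity⟩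

/-- The `q`-dimensional torus `ℝ^q/(2πℤ)^q`, with the max metric. -/
abbrev Torus (q : ℕ) := Fin q → AddCircle (2 * π)

/-- The exponential `x ↦ exp(i k·x)` on the torus. -/
def eK {q : ℕ} (k : Fin q → ℤ) : C(Torus q, ℂ) :=
  ⟨fun x => ∏ j, fourier (k j) (x j),
    continuous_finset_prod _ fun j _ => (map_continuous (fourier (k j))).comp (continuous_apply j)⟩

/-- The Euclidean norm `|k|₂` of a multi-integer. -/
def l2 {q : ℕ} (k : Fin q → ℤ) : ℝ := Real.sqrt (∑ j, ((k j : ℝ)) ^ 2)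

/-- The space `H_n^q` of trigonometric polynomials of spherical degree `< n`. -/
def trigSpan (q : ℕ) (n : ℝ) : Submodule ℂ C(Torus q, ℂ) :=
  Submodule.span ℂ {T | ∃ k : Fin q → ℤ, l2 k < n ∧ T = eK k}

/-- The degree of approximation `E_n(q; f)` in the supremum norm. -/
def degApprox (q : ℕ) (n : ℝ) (f : C(Torus q, ℂ)) : ℝ :=
  ⨅ T : ↥(trigSpan q n), ‖f - (T : C(Torus q, ℂ))‖

/-- The multivariate Fourier coefficient `f̂(k)`. -/
def mFourierCoeff {q : ℕ} (f : C(Torus q, ℂ)) (k : Fin q → ℤ) : ℂ :=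
  (1 / ((2 * π : ℝ) : ℂ) ^ q) * ∫ x : Torus q, f x * (starRingEnd ℂ) (eK k x)

/-- The box of frequencies used to write `Φ_N` and `σ_N` as finite sums. -/
def box (q : ℕ) (N : ℝ) : Finset (Fin q → ℤ) :=
  Finset.Icc (fun _ => -⌈N⌉) (fun _ => ⌈N⌉)

/-- The fixed smooth cutoff function `h`. -/
structure SmoothCutoff (h : ℝ → ℝ) : Prop where
  smooth : ContDiff ℝ (⊤ : ℕ∞) h
  even : ∀ t, h (-t) = h t
  nonneg : ∀ t, 0 ≤ h t
  le_one : ∀ t, h t ≤ 1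
  eq_one : ∀ t, |t| ≤ 1 / 2 → h t = 1
  eq_zero : ∀ t, 1 ≤ |t| → h t = 0

/-- The localized kernel `Φ_N(x) = Σ_k h(|k|₂/N) exp(i k·x)`. -/
def Phi (q : ℕ) (h : ℝ → ℝ) (N : ℝ) : C(Torus q, ℂ) :=
  ∑ k ∈ box q N, ((h (l2 k / N) : ℝ) : ℂ) • eK k

/-- The operator `σ_N(f)(x) = Σ_k h(|k|₂/N) f̂(k) exp(i k·x)`. -/
def sigmaOp (q : ℕ) (h : ℝ → ℝ) (N : ℝ) (f : C(Torus q, ℂ)) : C(Torus q, ℂ) :=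
  ∑ k ∈ box q N, (((h (l2 k / N) : ℝ) : ℂ) * mFourierCoeff f k) • eK k

/-- Minimal separation `η(C)` of the points of `C = {x_1, …, x_M}`. -/
def minSep {q M : ℕ} (x : Fin M → Torus q) : ℝ :=
  sInf {d | ∃ i j, x i ≠ x j ∧ d = dist (x i) (x j)}

/-- `x ↦ k·x` on the torus. -/
def dotk {q : ℕ} (k : Fin q → ℤ) : C(Torus q, AddCircle (2 * π)) :=
  ⟨fun x => ∑ j, k j • x j,
    continuous_finset_sum _ fun j _ => (continuous_zsmul (k j)).comp (continuous_apply j)⟩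

/-- `x ↦ φ(k·x − t)`, a single neuron. -/
def transK {q : ℕ} (φ : C(AddCircle (2 * π), ℂ)) (k : Fin q → ℤ) (t : ℝ) : C(Torus q, ℂ) :=
  φ.comp ⟨fun x => dotk k x - (t : AddCircle (2 * π)), (dotk k).continuous.sub continuous_const⟩

/-- The network `𝔾_Nt(φ, T)` associated with the trigonometric polynomial
`T = Σ_{k ∈ K} c k exp(i k ⬝ ·)`. -/
def Gop {q : ℕ} (φ : C(AddCircle (2 * π), ℂ)) (Nt : ℕ) (K : Finset (Fin q → ℤ))
    (c : (Fin q → ℤ) → ℂ) : C(Torus q, ℂ) :=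
  (1 / (((2 * Nt + 1 : ℕ) : ℂ) * fourierCoeff (⇑φ) 1)) •
    ∑ j ∈ Finset.range (2 * Nt + 1),
      Complex.exp (2 * (π : ℂ) * Complex.I * (j : ℂ) / ((2 * Nt + 1 : ℕ) : ℂ)) •
        ∑ k ∈ K, c k • transK φ k (2 * π * (j : ℝ) / ((2 * Nt + 1 : ℕ) : ℝ))

/-- The network `𝔾_Nt(φ, Φ_N)`. -/
def GPhiOp (q : ℕ) (h : ℝ → ℝ) (φ : C(AddCircle (2 * π), ℂ)) (Nt : ℕ) (N : ℝ) :
    C(Torus q, ℂ) :=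
  Gop φ Nt (box q N) fun k => ((h (l2 k / N) : ℝ) : ℂ)

/-- The network `𝔾_Nt(φ, σ_n(f))`. -/
def GsigmaOp (q : ℕ) (h : ℝ → ℝ) (φ : C(AddCircle (2 * π), ℂ)) (Nt : ℕ) (n : ℝ)
    (f : C(Torus q, ℂ)) : C(Torus q, ℂ) :=
  Gop φ Nt (box q n) fun k => ((h (l2 k / n) : ℝ) : ℂ) * mFourierCoeff f k

/-- Univariate trigonometric polynomials of degree `< n`. -/
def trigSpan1 (n : ℝ) : Submodule ℂ C(AddCircle (2 * π), ℂ) :=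
  Submodule.span ℂ {T | ∃ k : ℤ, |(k : ℝ)| < n ∧ T = fourier k}

/-- The univariate degree of approximation `E_n(1; φ)`. -/
def degApprox1 (n : ℝ) (φ : C(AddCircle (2 * π), ℂ)) : ℝ :=
  ⨅ T : ↥(trigSpan1 n), ‖φ - (T : C(AddCircle (2 * π), ℂ))‖

/-- Univariate trigonometric polynomials of degree `≤ m`. -/
def trigSpanLe1 (m : ℝ) : Submodule ℂ C(AddCircle (2 * π), ℂ) :=
  Submodule.span ℂ {T | ∃ k : ℤ, |(k : ℝ)| ≤ m ∧ T = fourier k}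

/-- The degree of approximation by univariate trigonometric polynomials of degree `≤ m`. -/
def degApproxLe1 (m : ℝ) (φ : C(AddCircle (2 * π), ℂ)) : ℝ :=
  ⨅ T : ↥(trigSpanLe1 m), ‖φ - (T : C(AddCircle (2 * π), ℂ))‖

/-- Projection of `ℝ^q` onto the torus. -/
def projT {q : ℕ} (x : Fin q → ℝ) : Torus q := fun j => (x j : AddCircle (2 * π))

/-- The `2π`-periodic lift to `ℝ^q` of a function on the torus. -/
def liftT {q : ℕ} (f : C(Torus q, ℂ)) : (Fin q → ℝ) → ℂ := fun x => f (projT x)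

/-- `f ∈ W*(𝕋^q)`: `f` is continuously differentiable. -/
def MemW {q : ℕ} (f : C(Torus q, ℂ)) : Prop := ContDiff ℝ 1 (liftT f)

/-- The `W*` seminorm `Σ_j ‖D_j f‖`. -/
def Wnorm {q : ℕ} (f : C(Torus q, ℂ)) : ℝ :=
  ∑ j, ⨆ x : Fin q → ℝ, ‖fderiv ℝ (liftT f) x (Pi.single j 1)‖

/-- Degree of approximation of a (not necessarily continuous) periodic function on `ℝ^q`. -/
def degApprox' (q : ℕ) (n : ℝ) (g : (Fin q → ℝ) → ℂ) : ℝ :=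
  ⨅ T : ↥(trigSpan q n), ⨆ x : Fin q → ℝ, ‖g x - (T : C(Torus q, ℂ)) (projT x)‖

/-- Degree of approximation of a (not necessarily continuous) `2π`-periodic function on `ℝ`. -/
def degApprox1' (n : ℝ) (g : ℝ → ℂ) : ℝ :=
  ⨅ T : ↥(trigSpan1 n), ⨆ t : ℝ, ‖g t - (T : C(AddCircle (2 * π), ℂ)) (t : AddCircle (2 * π))‖

/-- The regularization functional `R_N(T)`. -/
def regFunc {q M : ℕ} (N : ℝ) (x : Fin M → Torus q) (y : Fin M → ℂ) (T : C(Torus q, ℂ)) : ℝ :=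
  (⨆ j, ‖y j - T (x j)‖) + (1 / N) * Wnorm T

/-- Translate of a function on the torus. -/
def translateC {q : ℕ} (g : C(Torus q, ℂ)) (z : Torus q) : C(Torus q, ℂ) :=
  g.comp ⟨fun w => w - z, continuous_id.sub continuous_const⟩

/-- The interpolant `T^#_N(D) = σ_N(f) + Σ_j a_j Φ_N(· − x_j)`. -/
def interpolant {q M : ℕ} (h : ℝ → ℝ) (N : ℝ) (f : C(Torus q, ℂ)) (x : Fin M → Torus q)
    (a : Fin M → ℂ) : C(Torus q, ℂ) :=
  sigmaOp q h N f + ∑ j, a j • translateC (Phi q h N) (x j)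

end

theorem fourier_sub_apply {T : ℝ} (k : ℤ) (t s : AddCircle T) :
    fourier k (t - s) = fourier k t * fourier (-k) s := by
  simp only [fourier_apply, sub_eq_add_neg, smul_add, smul_neg, neg_smul,
    AddCircle.toCircle_add, Circle.coe_mul]

theorem fourier_sum_apply {T : ℝ} {ι : Type*} (s : Finset ι) (x : ι → AddCircle T) (n : ℤ) :
    fourier n (∑ i ∈ s, x i) = ∏ i ∈ s, fourier n (x i) := by
  classical
  induction s using Finset.induction_on with
  | empty => simp
  | insert a s ha ih =>
    rw [Finset.sum_insert ha, Finset.prod_insert ha, ← ih]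
    simp only [fourier_apply, smul_add, AddCircle.toCircle_add, Circle.coe_mul]

theorem eK_apply_eq_fourier_dotk {q : ℕ} (k : Fin q → ℤ) (x : Torus q) :
    eK k x = fourier 1 (dotk k x) := by
  simp only [eK, dotk, ContinuousMap.coe_mk, fourier_sum_apply]
  simp only [fourier_apply, one_smul]

/-- The `j`-th node `2πj/M`, evaluated by the character of frequency `n`, is a power of the
standard primitive `M`-th root of unity. -/
theorem fourier_node (M j : ℕ) (n : ℤ) :
    fourier n ((2 * π * (j : ℝ) / (M : ℝ) : ℝ) : AddCircle (2 * π)) =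
      (Complex.exp (2 * π * Complex.I / M) ^ n) ^ j := by
  rw [fourier_coe_apply, ← Complex.exp_int_mul, ← Complex.exp_nat_mul]
  congr 1
  have : (π : ℂ) ≠ 0 := by exact_mod_cast pi_ne_zero
  push_cast
  field_simp

theorem sum_range_fourier_node {M : ℕ} (hM : M ≠ 0) (n : ℤ) :
    ∑ j ∈ Finset.range M, fourier n ((2 * π * (j : ℝ) / (M : ℝ) : ℝ) : AddCircle (2 * π)) =
      if (M : ℤ) ∣ n then (M : ℂ) else 0 := by
  have hζ := Complex.isPrimitiveRoot_exp M hM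
  simp only [fourier_node]
  split_ifs with h
  · simp [(hζ.zpow_eq_one_iff_dvd n).2 h]
  · have h1 := mt (hζ.zpow_eq_one_iff_dvd n).1 h
    rw [geom_sum_eq h1, ← zpow_natCast, ← zpow_mul, mul_comm n, zpow_mul, zpow_natCast,
      hζ.pow_eq_one, one_zpow, sub_self, zero_div]

theorem integrable_haarAddCircle (g : C(AddCircle (2 * π), ℂ)) :
    Integrable (⇑g) AddCircle.haarAddCircle :=
  g.continuous.integrable_of_hasCompactSupport (HasCompactSupport.of_compactSpace _)

theorem fourierCoeff_sub (f g : C(AddCircle (2 * π), ℂ)) (n : ℤ) :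
    fourierCoeff (⇑(f - g)) n = fourierCoeff (⇑f) n - fourierCoeff (⇑g) n := by
  have h := congrFun (fourierCoeff.add (integrable_haarAddCircle (f - g))
    (integrable_haarAddCircle g)) n
  rw [← ContinuousMap.coe_add, sub_add_cancel] at h
  exact eq_sub_of_add_eq h.symm

theorem norm_fourierCoeff_le (g : C(AddCircle (2 * π), ℂ)) (n : ℤ) :
    ‖fourierCoeff (⇑g) n‖ ≤ ‖g‖ := by
  have h : ∀ t : AddCircle (2 * π), ‖fourier (-n) t • g t‖ ≤ ‖g‖ := fun t => by
    rw [norm_smul, fourier_apply, Circle.norm_coe, one_mul]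
    exact g.norm_coe_le_norm t
  simpa [fourierCoeff] using norm_integral_le_of_norm_le_const
    (μ := AddCircle.haarAddCircle) (Filter.Eventually.of_forall h)

/-- Discretized convolution with `exp(i ·)` on `2N + 1` nodes is exact on `H_N^1`. -/
theorem sum_node_trigSpan1 {N : ℕ} {P : C(AddCircle (2 * π), ℂ)} (hP : P ∈ trigSpan1 N)
    (t : AddCircle (2 * π)) :
    ∑ j ∈ Finset.range (2 * N + 1),
        fourier 1 ((2 * π * (j : ℝ) / ((2 * N + 1 : ℕ) : ℝ) : ℝ) : AddCircle (2 * π)) *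
          P (t - ((2 * π * (j : ℝ) / ((2 * N + 1 : ℕ) : ℝ) : ℝ) : AddCircle (2 * π))) =
      ((2 * N + 1 : ℕ) : ℂ) * fourierCoeff (⇑P) 1 * fourier 1 t := by
  induction hP using Submodule.span_induction with
  | mem P h =>
    obtain ⟨k, hk, rfl⟩ := h
    have hk' : |k| < (N : ℤ) := by exact_mod_cast hk
    have hterm : ∀ s : AddCircle (2 * π),
        fourier 1 s * fourier k (t - s) = fourier k t * fourier (1 - k) s := fun s => by
      rw [fourier_sub_apply, sub_eq_add_neg, fourier_add]
      ring
    simp only [hterm]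
    rw [← Finset.mul_sum, sum_range_fourier_node (by omega), fourierCoeff_fourier]
    by_cases h1 : k = 1
    · subst h1
      simp [mul_comm]
    · have hnd : ¬ (((2 * N + 1 : ℕ) : ℤ) ∣ 1 - k) := fun hd => by
        have habs := abs_lt.1 hk'
        have := Int.eq_zero_of_abs_lt_dvd hd (abs_lt.2 ⟨by push_cast; omega, by push_cast; omega⟩)
        omega
      rw [if_neg hnd, Pi.single_eq_of_ne (Ne.symm h1), mul_zero, mul_zero, zero_mul]
  | zero => simp [fourierCoeff]
  | add P Q _ _ hP hQ =>
    have hadd := congrFun (fourierCoeff.add (integrable_haarAddCircle P)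
      (integrable_haarAddCircle Q)) 1
    simp only [ContinuousMap.add_apply, mul_add, Finset.sum_add_distrib, hP, hQ,
      ContinuousMap.coe_add, hadd, Pi.add_apply]
    ring
  | smul c P _ hP =>
    rw [ContinuousMap.coe_smul, fourierCoeff.const_smul]
    simp only [Pi.smul_apply, smul_eq_mul, mul_left_comm _ c, ← Finset.mul_sum, hP]
    ring

theorem norm_fourier_sub_network_le (φ : C(AddCircle (2 * π), ℂ))
    (hφ : fourierCoeff (⇑φ) 1 ≠ 0) {N : ℕ} {P : C(AddCircle (2 * π), ℂ)} (hP : P ∈ trigSpan1 N)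
    (t : AddCircle (2 * π)) :
    ‖fourier 1 t - 1 / (((2 * N + 1 : ℕ) : ℂ) * fourierCoeff (⇑φ) 1) *
        ∑ j ∈ Finset.range (2 * N + 1),
          fourier 1 ((2 * π * (j : ℝ) / ((2 * N + 1 : ℕ) : ℝ) : ℝ) : AddCircle (2 * π)) *
            φ (t - ((2 * π * (j : ℝ) / ((2 * N + 1 : ℕ) : ℝ) : ℝ) : AddCircle (2 * π)))‖ ≤
      2 / ‖fourierCoeff (⇑φ) 1‖ * ‖φ - P‖ := by
  set M : ℕ := 2 * N + 1 with hM
  set s : ℕ → AddCircle (2 * π) := fun j => ((2 * π * (j : ℝ) / (M : ℝ) : ℝ) : AddCircle (2 * π))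
  set a := fourierCoeff (⇑φ) 1
  have hM0 : (M : ℂ) ≠ 0 := by exact_mod_cast (by omega : M ≠ 0)
  have hMpos : (0 : ℝ) < M := by exact_mod_cast (by omega : 0 < M)
  have ha : 0 < ‖a‖ := norm_pos_iff.2 hφ
  have hnorm : ∀ x : AddCircle (2 * π), ‖(fourier 1 x : ℂ)‖ = 1 := fun x => by
    rw [fourier_apply, Circle.norm_coe]
  have hsum : ‖∑ j ∈ Finset.range M, fourier 1 (s j) * (φ - P) (t - s j)‖ ≤ M * ‖φ - P‖ := by
    refine (norm_sum_le_of_le _ (f := fun j => fourier 1 (s j) * (φ - P) (t - s j))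
      (n := fun _ => ‖φ - P‖) fun j _ => ?_).trans (by simp)
    rw [norm_mul, hnorm, one_mul]
    exact (φ - P).norm_coe_le_norm _
  have hP' : ∑ j ∈ Finset.range M, fourier 1 (s j) * P (t - s j) =
      M * fourierCoeff (⇑P) 1 * fourier 1 t := sum_node_trigSpan1 hP t
  have key : fourier 1 t - 1 / (M * a) * ∑ j ∈ Finset.range M, fourier 1 (s j) * φ (t - s j) =
      a⁻¹ * (fourierCoeff (⇑(φ - P)) 1 * fourier 1 t -
        (M : ℂ)⁻¹ * ∑ j ∈ Finset.range M, fourier 1 (s j) * (φ - P) (t - s j)) := by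
    simp only [ContinuousMap.sub_apply, mul_sub, Finset.sum_sub_distrib, hP', fourierCoeff_sub]
    change _ = a⁻¹ * ((a - _) * _) - _
    field_simp
    ring
  rw [key, norm_mul, norm_inv, div_mul_eq_mul_div, div_eq_inv_mul]
  gcongr
  refine (norm_sub_le _ _).trans ?_
  rw [norm_mul, hnorm, mul_one, norm_mul, norm_inv, Complex.norm_natCast, two_mul ‖φ - P‖]
  refine add_le_add (norm_fourierCoeff_le _ _) ?_
  rwa [inv_mul_le_iff₀ hMpos]

/-- a single exponential `exp(i k·x)` is approximated in the uniform norm by a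
discretized network built from any activation `φ` with `φ̂(1) ≠ 0`, with error
`(4/|φ̂(1)|) E_N(1; φ)`. -/
theorem exp_approx_by_network (q : ℕ) (φ : C(AddCircle (2 * π), ℂ))
    (hφ : fourierCoeff (⇑φ) 1 ≠ 0) (N : ℕ) (hN : 1 ≤ N) (k : Fin q → ℤ) :
    ‖eK k - (1 / (((2 * N + 1 : ℕ) : ℂ) * fourierCoeff (⇑φ) 1)) •
        ∑ j ∈ Finset.range (2 * N + 1),
          Complex.exp (2 * (π : ℂ) * Complex.I * (j : ℂ) / ((2 * N + 1 : ℕ) : ℂ)) •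
            transK φ k (2 * π * (j : ℝ) / ((2 * N + 1 : ℕ) : ℝ))‖
      ≤ 4 / ‖fourierCoeff (⇑φ) 1‖ * degApprox1 (N : ℝ) φ := by
  have ha : 0 < ‖fourierCoeff (⇑φ) 1‖ := norm_pos_iff.2 hφ
  rw [← div_le_iff₀' (by positivity)]
  refine le_ciInf fun P => ?_
  rw [div_le_iff₀' (by positivity)]
  refine (ContinuousMap.norm_le _ (by positivity)).2 fun x => ?_
  have hnode : ∀ j : ℕ,
      Complex.exp (2 * (π : ℂ) * Complex.I * (j : ℂ) / ((2 * N + 1 : ℕ) : ℂ)) =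
        fourier 1 ((2 * π * (j : ℝ) / ((2 * N + 1 : ℕ) : ℝ) : ℝ) : AddCircle (2 * π)) :=
    fun j => by
      rw [fourier_node, zpow_one, ← Complex.exp_nat_mul]
      congr 1
      ring
  have h := norm_fourier_sub_network_le φ hφ P.2 (dotk k x)
  refine le_trans (le_of_eq ?_) (h.trans ?_)
  · simp only [ContinuousMap.sub_apply, ContinuousMap.smul_apply, ContinuousMap.sum_apply,
      smul_eq_mul, hnode, eK_apply_eq_fourier_dotk]
    rfl
  · gcongr
    norm_num
end

section
/- Let f ∈ W*(𝕋^q), let B be as in the interpolation theorem (Theorem on T#_N(D)), and let N ≥ B η(C)^{-1}. Define the regularization functional R_N(T) = max_{1≤j≤M} |y_j − T(x_j)| + (1/N) ‖T‖_{W*} for T ∈ H_N^q, and let T*(D) = argmin_{T ∈ H_N^q} R_N(T). Then max_{1≤j≤M} |y_j − T*(D)(x_j)| ≤ min_{T ∈ H_N^q} R_N(T) ≤ c { ε + (1/N) ‖f‖_{W*} }, where c depends only on q, h, S (good training error). -/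
open MeasureTheory Real

noncomputable section JacksonKernel

open AddCircle Finset

/-- The coefficients `sin ((k + 1) π / (n + 2))` of the optimal positive kernel. -/
def sineCoeff (n k : ℕ) : ℝ := Real.sin ((k + 1) * (π / (n + 2)))

theorem sum_sineCoeff_mul_succ (n : ℕ) :
    ∑ k ∈ range n, sineCoeff n k * sineCoeff n (k + 1) =
      Real.cos (π / (n + 2)) * ∑ k ∈ range (n + 1), sineCoeff n k ^ 2 := by
  set θ := π / ((n : ℝ) + 2) with hθ
  have key : ∀ m : ℕ, ∑ k ∈ range (m + 1),
      (2 * Real.cos θ * sineCoeff n k ^ 2 - 2 * (sineCoeff n k * sineCoeff n (k + 1))) =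
      - (sineCoeff n m * sineCoeff n (m + 1)) := by
    have rec' : ∀ k : ℕ, 2 * Real.cos θ * sineCoeff n k =
        sineCoeff n (k + 1) + Real.sin (k * θ) := by
      intro k
      simp only [sineCoeff, ← hθ]
      push_cast
      rw [show ((k : ℝ) + 1 + 1) * θ = (k + 1) * θ + θ by ring,
        show (k : ℝ) * θ = (k + 1) * θ - θ by ring, Real.sin_add, Real.sin_sub]
      ring
    intro m
    induction m with
    | zero =>
      have := rec' 0
      simp only [Nat.cast_zero, zero_mul, Real.sin_zero, add_zero] at this
      simp only [zero_add, range_one, sum_singleton]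
      linear_combination sineCoeff n 0 * this
    | succ m ih =>
      rw [sum_range_succ, ih]
      have := rec' (m + 1)
      have h2 : Real.sin (((m + 1 : ℕ) : ℝ) * θ) = sineCoeff n m := by
        simp [sineCoeff, ← hθ]
      rw [h2] at this
      linear_combination sineCoeff n (m + 1) * this
  have hlast : sineCoeff n (n + 1) = 0 := by
    simp only [sineCoeff]
    push_cast
    rw [show ((n : ℝ) + 1 + 1) * (π / (n + 2)) = π by field_simp; ring, Real.sin_pi]
  have h := key n
  rw [hlast, sum_sub_distrib, ← mul_sum, ← mul_sum, sum_range_succ (fun k =>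
    sineCoeff n k * sineCoeff n (k + 1)), hlast] at h
  linarith

/-- The total mass of the squared coefficients. -/
def sineMass (n : ℕ) : ℝ := ∑ k ∈ range (n + 1), sineCoeff n k ^ 2

theorem sineMass_pos (n : ℕ) : 0 < sineMass n := by
  refine sum_pos (fun k hk => pow_pos (Real.sin_pos_of_pos_of_lt_pi (by positivity) ?_) 2) (by simp)
  rw [mul_div_assoc', div_lt_iff₀ (by positivity), mul_comm]
  have : (k : ℝ) + 1 ≤ n + 1 := by exact_mod_cast mem_range.1 hk
  exact mul_lt_mul_of_pos_left (by linarith) pi_pos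

/-- The normalized positive kernel of degree `n` on the circle. -/
def jacksonKernel (n : ℕ) (t : AddCircle (2 * π)) : ℝ :=
  (sineMass n)⁻¹ * ‖∑ k ∈ range (n + 1), (sineCoeff n k : ℂ) * fourier (k : ℤ) t‖ ^ 2

/-- The Fourier coefficients of `jacksonKernel`, indexed by pairs. -/
def jacksonCoeff (n : ℕ) (p : ℕ × ℕ) : ℂ :=
  ((sineMass n)⁻¹ * (sineCoeff n p.1 * sineCoeff n p.2) : ℝ)

theorem jacksonKernel_nonneg (n : ℕ) (t : AddCircle (2 * π)) : 0 ≤ jacksonKernel n t :=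
  mul_nonneg (inv_nonneg.2 (sineMass_pos n).le) (sq_nonneg _)

theorem continuous_jacksonKernel (n : ℕ) : Continuous (jacksonKernel n) := by
  unfold jacksonKernel
  fun_prop

theorem jacksonKernel_eq_sum (n : ℕ) (t : AddCircle (2 * π)) :
    (jacksonKernel n t : ℂ) = ∑ p ∈ range (n + 1) ×ˢ range (n + 1),
      jacksonCoeff n p * fourier ((p.1 : ℤ) - p.2) t := by
  rw [jacksonKernel]
  push_cast
  rw [← Complex.mul_conj', map_sum, sum_mul_sum, ← sum_product', mul_sum]
  refine sum_congr rfl fun p _ => ?_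
  rw [sub_eq_add_neg, fourier_add, fourier_neg, jacksonCoeff, map_mul, Complex.conj_ofReal]
  push_cast
  ring

theorem integral_fourier (m : ℤ) :
    ∫ t : AddCircle (2 * π), fourier m t ∂haarAddCircle = if m = 0 then 1 else 0 := by
  have h := congrFun (fourierCoeff_fourier (T := 2 * π) m) 0
  rw [fourierCoeff] at h
  simp only [neg_zero, fourier_zero, one_smul] at h
  rw [h, Pi.single_apply]
  simp [eq_comm]

theorem integrable_of_continuous_circle {E : Type*} [NormedAddCommGroup E]
    {g : AddCircle (2 * π) → E} (hg : Continuous g) : Integrable g haarAddCircle :=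
  hg.integrable_of_hasCompactSupport (HasCompactSupport.of_compactSpace g)

theorem integral_jacksonKernel_mul_fourier (n : ℕ) (m : ℤ) :
    ∫ t, (jacksonKernel n t : ℂ) * fourier m t ∂haarAddCircle =
      ∑ p ∈ range (n + 1) ×ˢ range (n + 1),
        if (p.1 : ℤ) - p.2 + m = 0 then jacksonCoeff n p else 0 := by
  simp_rw [jacksonKernel_eq_sum, sum_mul, mul_assoc, ← fourier_add]
  rw [integral_finsetSum]
  · refine sum_congr rfl fun p _ => ?_
    rw [integral_const_mul, integral_fourier]
    simp
  · exact fun p _ => integrable_of_continuous_circle (by fun_prop)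

theorem integral_jacksonKernel (n : ℕ) : ∫ t, jacksonKernel n t ∂haarAddCircle = 1 := by
  have h := integral_jacksonKernel_mul_fourier n 0
  simp only [fourier_zero, mul_one, add_zero, sub_eq_zero, Nat.cast_inj] at h
  rw [integral_complex_ofReal, sum_product] at h
  simp only [sum_ite_eq, jacksonCoeff] at h
  rw [sum_congr rfl (fun x hx => if_pos hx)] at h
  norm_cast at h
  rw [h, ← mul_sum, sum_congr rfl (fun x _ => (sq (sineCoeff n x)).symm)]
  exact inv_mul_cancel₀ (sineMass_pos n).ne'

theorem integral_jacksonKernel_mul_cos (n : ℕ) :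
    ∫ t, jacksonKernel n t * (fourier 1 t).re ∂haarAddCircle = Real.cos (π / (n + 2)) := by
  have h := integral_jacksonKernel_mul_fourier n 1
  have hre := congrArg Complex.re h
  rw [← RCLike.re_eq_complex_re, ← integral_re (integrable_of_continuous_circle
    (by have := continuous_jacksonKernel n; fun_prop))] at hre
  simp only [RCLike.re_eq_complex_re, Complex.re_ofReal_mul] at hre
  rw [hre, sum_product]
  have : ∀ i ∈ range (n + 1), ∑ j ∈ range (n + 1),
      (if ((i : ℤ) - j + 1 = 0) then jacksonCoeff n (i, j) else 0) =
      if i ∈ range n then jacksonCoeff n (i, i + 1) else 0 := by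
    intro i _
    have h1 : ∀ j : ℕ, ((i : ℤ) - j + 1 = 0) ↔ i + 1 = j := by intro j; omega
    simp only [h1, sum_ite_eq, mem_range, add_lt_add_iff_right]
  rw [sum_congr rfl this, ← sum_filter, filter_mem_eq_inter,
    inter_eq_right.2 (range_subset_range.2 n.le_succ)]
  simp only [jacksonCoeff]
  rw [← Complex.ofReal_sum, Complex.ofReal_re, ← mul_sum, sum_sineCoeff_mul_succ]
  have := (sineMass_pos n).ne'
  unfold sineMass at *
  field_simp

theorem exists_coe_eq_abs_eq_norm (u : AddCircle (2 * π)) :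
    ∃ U : ℝ, (U : AddCircle (2 * π)) = u ∧ |U| = ‖u‖ ∧ |U| ≤ π := by
  obtain ⟨⟨U, hU⟩, rfl⟩ := (AddCircle.equivIoc (2 * π) (-π)).symm.surjective u
  have hle : |U| ≤ π := abs_le.2 ⟨hU.1.le, by linarith [hU.2]⟩
  refine ⟨U, rfl, ((norm_coe_eq_abs_iff (2 * π) two_pi_pos.ne').2 ?_).symm, hle⟩
  rwa [abs_of_pos two_pi_pos, mul_div_cancel_left₀ _ two_ne_zero]

theorem norm_sq_le_one_sub_cos (u : AddCircle (2 * π)) :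
    ‖u‖ ^ 2 ≤ π ^ 2 / 2 * (1 - (fourier 1 u).re) := by
  obtain ⟨U, rfl, hn, hU⟩ := exists_coe_eq_abs_eq_norm u
  have h := Real.cos_le_one_sub_mul_cos_sq hU
  have hre : (fourier 1 (U : AddCircle (2 * π))).re = Real.cos U := by
    rw [fourier_coe_apply, ← Complex.exp_ofReal_mul_I_re]
    congr 2
    push_cast
    field_simp
  rw [hre, ← hn, sq_abs]
  have : U ^ 2 = π ^ 2 / 2 * (2 / π ^ 2 * U ^ 2) := by field_simp
  rw [this]
  gcongr
  linarith

/-- The constant in the first moment bound for `jacksonKernel`. -/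
def jacksonConst : ℝ := (π ^ 4 / 4 + 1) / 2

theorem integral_norm_mul_jacksonKernel_le (n : ℕ) :
    ∫ t, ‖t‖ * jacksonKernel n t ∂haarAddCircle ≤ jacksonConst / (n + 1) := by
  have hc := continuous_jacksonKernel n
  have hn : (0 : ℝ) < n + 1 := by positivity
  have hpt : ∀ t : AddCircle (2 * π), ‖t‖ * jacksonKernel n t ≤
      (((n + 1) * (π ^ 2 / 2) + 1 / (n + 1)) / 2) * jacksonKernel n t -
        ((n + 1) * (π ^ 2 / 2) / 2) * (jacksonKernel n t * (fourier 1 t).re) := by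
    intro t
    have h1 := norm_sq_le_one_sub_cos t
    have h2 : ‖t‖ ≤ ((n + 1) * ‖t‖ ^ 2 + 1 / (n + 1)) / 2 := by
      rw [← sub_nonneg]
      have : ((n + 1) * ‖t‖ ^ 2 + 1 / (n + 1)) / 2 - ‖t‖ =
          ((n + 1) * ‖t‖ - 1) ^ 2 / (2 * ((n : ℝ) + 1)) := by field_simp; ring
      rw [this]
      positivity
    have h3 : ‖t‖ ≤ ((n + 1) * (π ^ 2 / 2 * (1 - (fourier 1 t).re)) + 1 / (n + 1)) / 2 :=
      h2.trans (by gcongr)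
    calc _ ≤ _ := mul_le_mul_of_nonneg_right h3 (jacksonKernel_nonneg n t)
      _ = _ := by ring
  have hI : ∀ g : AddCircle (2 * π) → ℝ, Continuous g → Integrable g haarAddCircle :=
    fun g hg => integrable_of_continuous_circle hg
  have hmono := integral_mono (hI _ (by fun_prop)) (hI _ (by fun_prop)) hpt
  rw [integral_sub (hI _ (by fun_prop)) (hI _ (by fun_prop)), integral_const_mul,
    integral_const_mul, integral_jacksonKernel, integral_jacksonKernel_mul_cos] at hmono
  refine hmono.trans ?_
  have hcos := Real.one_sub_sq_div_two_le_cos (x := π / ((n : ℝ) + 2))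
  have hθ : (π / ((n : ℝ) + 2)) ^ 2 ≤ (π / ((n : ℝ) + 1)) ^ 2 := by gcongr; linarith
  have h4 : 1 - Real.cos (π / ((n : ℝ) + 2)) ≤ (π / ((n : ℝ) + 1)) ^ 2 / 2 := by linarith
  calc _ = ((n + 1) * (π ^ 2 / 2) / 2) * (1 - Real.cos (π / ((n : ℝ) + 2)))
        + 1 / (n + 1) / 2 := by ring
    _ ≤ ((n + 1) * (π ^ 2 / 2) / 2) * ((π / ((n : ℝ) + 1)) ^ 2 / 2) + 1 / (n + 1) / 2 := by gcongr
    _ = _ := by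
      unfold jacksonConst
      field_simp
      ring

end JacksonKernel

noncomputable section JacksonMean

open AddCircle Finset

variable {q : ℕ}

theorem eK_add (k : Fin q → ℤ) (x y : Torus q) : eK k (x + y) = eK k x * eK k y := by
  simp only [eK, ContinuousMap.coe_mk, Pi.add_apply, ← prod_mul_distrib]
  refine prod_congr rfl fun j _ => ?_
  simp only [fourier_apply, smul_add, toCircle_add, Circle.coe_mul]

instance isNegInvariant_haarAddCircle :
    (haarAddCircle : Measure (AddCircle (2 * π))).IsNegInvariant := by
  unfold haarAddCircle
  infer_instance

/-- The normalized Haar measure on the torus. -/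
abbrev torusHaar (q : ℕ) : Measure (Torus q) := Measure.pi fun _ => haarAddCircle

/-- The product kernel on the torus. -/
def productKernel (n : ℕ) (u : Torus q) : ℝ := ∏ j, jacksonKernel n (u j)

theorem productKernel_nonneg (n : ℕ) (u : Torus q) : 0 ≤ productKernel n u :=
  prod_nonneg fun _ _ => jacksonKernel_nonneg n _

theorem continuous_productKernel (n : ℕ) : Continuous (productKernel n : Torus q → ℝ) := by
  have := continuous_jacksonKernel n
  unfold productKernel
  fun_prop

theorem integrable_of_continuous_torus {E : Type*} [NormedAddCommGroup E]
    {g : Torus q → E} (hg : Continuous g) : Integrable g (torusHaar q) :=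
  hg.integrable_of_hasCompactSupport (HasCompactSupport.of_compactSpace g)

theorem integral_productKernel (n : ℕ) : ∫ u, productKernel n u ∂torusHaar q = 1 := by
  unfold productKernel
  rw [integral_fintype_prod_eq_prod (fun _ => jacksonKernel n)]
  simp [integral_jacksonKernel]

theorem integral_norm_mul_productKernel_le (n : ℕ) (i : Fin q) :
    ∫ u, ‖u i‖ * productKernel n u ∂torusHaar q ≤ jacksonConst / (n + 1) := by
  have h : ∀ u : Torus q, ‖u i‖ * productKernel n u =
      ∏ j, (if j = i then fun t => ‖t‖ * jacksonKernel n t else jacksonKernel n) (u j) := by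
    intro u
    rw [productKernel, ← mul_prod_erase univ _ (mem_univ i), ← mul_prod_erase univ
      (fun j => (if j = i then fun t => ‖t‖ * jacksonKernel n t else jacksonKernel n) (u j))
      (mem_univ i), if_pos rfl, mul_assoc]
    congr 2
    exact prod_congr rfl fun j hj => by rw [if_neg (ne_of_mem_erase hj)]
  simp_rw [h]
  rw [integral_fintype_prod_eq_prod, prod_eq_single i]
  · simpa using integral_norm_mul_jacksonKernel_le n
  · intro j _ hj
    simp [hj, integral_jacksonKernel]
  · simp

/-- The index set of the Fourier expansion of `productKernel`. -/
def pairBox (q n : ℕ) : Finset (Fin q → ℕ × ℕ) :=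
  Fintype.piFinset fun _ => range (n + 1) ×ˢ range (n + 1)

/-- The frequency attached to a family of pairs. -/
def pairFreq (p : Fin q → ℕ × ℕ) : Fin q → ℤ := fun j => ((p j).1 : ℤ) - (p j).2

theorem productKernel_eq_sum (n : ℕ) (u : Torus q) :
    (productKernel n u : ℂ) =
      ∑ p ∈ pairBox q n, (∏ j, jacksonCoeff n (p j)) * eK (pairFreq p) u := by
  rw [productKernel, Complex.ofReal_prod]
  simp_rw [jacksonKernel_eq_sum]
  rw [prod_univ_sum]
  exact sum_congr rfl fun p _ => prod_mul_distrib

/-- The convolution of `f` with `productKernel`, as an explicit trigonometric polynomial. -/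
def jacksonMean (n : ℕ) (f : C(Torus q, ℂ)) : C(Torus q, ℂ) :=
  ∑ p ∈ pairBox q n, ((∏ j, jacksonCoeff n (p j)) *
    ∫ u, f u * eK (pairFreq p) (-u) ∂torusHaar q) • eK (pairFreq p)

theorem jacksonMean_apply (n : ℕ) (f : C(Torus q, ℂ)) (x : Torus q) :
    jacksonMean n f x = ∫ u, f (x - u) * productKernel n u ∂torusHaar q := by
  rw [← integral_sub_left_eq_self (fun u => f (x - u) * (productKernel n u : ℂ)) (torusHaar q) x]
  simp only [sub_sub_cancel]
  simp only [productKernel_eq_sum, mul_sum, sub_eq_add_neg x, eK_add]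
  rw [integral_finsetSum _ fun p _ => integrable_of_continuous_torus (by fun_prop)]
  simp only [jacksonMean, ContinuousMap.coe_sum, Finset.sum_apply, ContinuousMap.coe_smul,
    Pi.smul_apply, smul_eq_mul]
  refine sum_congr rfl fun p _ => ?_
  rw [mul_assoc, mul_comm _ (eK (pairFreq p) x), ← mul_assoc, ← integral_const_mul]
  exact integral_congr_ae (.of_forall fun u => by ring)

theorem l2_pairFreq_le {n : ℕ} {p : Fin q → ℕ × ℕ} (hp : p ∈ pairBox q n) :
    l2 (pairFreq p) ≤ q * n := by
  refine Real.sqrt_le_iff.2 ⟨by positivity, ?_⟩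
  have h : ∀ j, ((pairFreq p j : ℤ) : ℝ) ^ 2 ≤ (n : ℝ) ^ 2 := by
    intro j
    have := Fintype.mem_piFinset.1 hp j
    simp only [mem_product, mem_range] at this
    refine sq_le_sq' ?_ ?_
    · have : -(n : ℤ) ≤ pairFreq p j := by simp only [pairFreq]; omega
      exact_mod_cast this
    · have : pairFreq p j ≤ (n : ℤ) := by simp only [pairFreq]; omega
      exact_mod_cast this
  calc _ ≤ ∑ _j : Fin q, (n : ℝ) ^ 2 := sum_le_sum fun j _ => h j
    _ = q * (n : ℝ) ^ 2 := by simp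
    _ ≤ (q * n) ^ 2 := by
      rw [mul_pow]
      gcongr
      exact_mod_cast Nat.le_self_pow two_ne_zero q

theorem jacksonMean_mem_trigSpan {n : ℕ} {N : ℝ} (hN : q * n < N) (f : C(Torus q, ℂ)) :
    jacksonMean n f ∈ trigSpan q N :=
  Submodule.sum_mem _ fun p hp => Submodule.smul_mem _ _
    (Submodule.subset_span ⟨pairFreq p, (l2_pairFreq_le hp).trans_lt hN, rfl⟩)

/-- The supremum norm of the `j`-th partial derivative. -/
def partialSup (f : C(Torus q, ℂ)) (j : Fin q) : ℝ :=
  ⨆ x : Fin q → ℝ, ‖fderiv ℝ (liftT f) x (Pi.single j 1)‖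

theorem partialSup_nonneg (f : C(Torus q, ℂ)) (j : Fin q) : 0 ≤ partialSup f j :=
  Real.iSup_nonneg fun _ => norm_nonneg _

theorem Wnorm_nonneg (f : C(Torus q, ℂ)) : 0 ≤ Wnorm f :=
  sum_nonneg fun j _ => partialSup_nonneg f j

theorem projT_add (x y : Fin q → ℝ) : projT (x + y) = projT x + projT y := rfl

theorem exists_projT_eq (u : Torus q) :
    ∃ U : Fin q → ℝ, projT U = u ∧ ∀ j, |U j| = ‖u j‖ ∧ |U j| ≤ π := by
  choose U hU using fun j => exists_coe_eq_abs_eq_norm (u j)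
  exact ⟨U, funext fun j => (hU j).1, fun j => (hU j).2⟩

theorem fderiv_liftT_congr (f : C(Torus q, ℂ)) {x y : Fin q → ℝ} (h : projT x = projT y) :
    fderiv ℝ (liftT f) x = fderiv ℝ (liftT f) y := by
  have hper : (fun z => liftT f (z + (x - y))) = liftT f := by
    funext z
    have : projT (x - y) = 0 := by
      have h2 := projT_add (x - y) y
      rwa [sub_add_cancel, h, right_eq_add] at h2
    simp only [liftT, projT_add, this, add_zero]
  have := fderiv_comp_add_right (𝕜 := ℝ) (f := liftT f) (x := y) (x - y)
  rw [hper, add_sub_cancel] at this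
  exact this.symm

theorem norm_fderiv_le_partialSup {f : C(Torus q, ℂ)} (hf : MemW f) (j : Fin q)
    (x : Fin q → ℝ) : ‖fderiv ℝ (liftT f) x (Pi.single j 1)‖ ≤ partialSup f j := by
  have hc : Continuous fun x => fderiv ℝ (liftT f) x (Pi.single j 1) :=
    (hf.continuous_fderiv one_ne_zero).clm_apply continuous_const
  obtain ⟨C, hC⟩ := (isCompact_closedBall (0 : Fin q → ℝ) π).exists_bound_of_continuousOn
    hc.continuousOn
  refine le_ciSup (f := fun x => ‖fderiv ℝ (liftT f) x (Pi.single j 1)‖) ⟨C, ?_⟩ x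
  rintro _ ⟨y, rfl⟩
  obtain ⟨U, hU, hle⟩ := exists_projT_eq (projT y)
  simp only [← fderiv_liftT_congr f hU]
  exact hC U (mem_closedBall_zero_iff.2 ((pi_norm_le_iff_of_nonneg pi_pos.le).2
    fun i => (hle i).2))

theorem norm_liftT_add_sub_le {f : C(Torus q, ℂ)} (hf : MemW f) (x v : Fin q → ℝ) :
    ‖liftT f (x + v) - liftT f x‖ ≤ ∑ j, |v j| * partialSup f j := by
  have hd : ∀ s ∈ Set.Icc (0 : ℝ) 1, HasDerivWithinAt (fun s : ℝ => liftT f (x + s • v))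
      (fderiv ℝ (liftT f) (x + s • v) v) (Set.Icc 0 1) s := by
    intro s _
    have h1 : HasDerivAt (fun s : ℝ => x + s • v) v s := by
      simpa using ((hasDerivAt_id s).smul_const v).const_add x
    exact (((hf.differentiable one_ne_zero _).hasFDerivAt).comp_hasDerivAt s h1).hasDerivWithinAt
  have hb : ∀ s ∈ Set.Ico (0 : ℝ) 1, ‖fderiv ℝ (liftT f) (x + s • v) v‖ ≤
      ∑ j, |v j| * partialSup f j := by
    intro s _
    conv_lhs => enter [1, 2]; rw [pi_eq_sum_univ' v]
    rw [map_sum]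
    refine (norm_sum_le _ _).trans (sum_le_sum fun j _ => ?_)
    rw [map_smul, norm_smul, Real.norm_eq_abs]
    refine mul_le_mul_of_nonneg_left ?_ (abs_nonneg _)
    exact norm_fderiv_le_partialSup hf j (x + s • v)
  simpa using norm_image_sub_le_of_norm_deriv_le_segment_01' hd hb

theorem norm_apply_sub_sub_le {f : C(Torus q, ℂ)} (hf : MemW f) (x u : Torus q) :
    ‖f (x - u) - f x‖ ≤ ∑ j, ‖u j‖ * partialSup f j := by
  obtain ⟨X, rfl, -⟩ := exists_projT_eq x
  obtain ⟨U, hU, hn⟩ := exists_projT_eq (-u)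
  have h := norm_liftT_add_sub_le hf X U
  simp only [liftT, projT_add, hU, ← sub_eq_add_neg, (hn _).1, Pi.neg_apply, norm_neg] at h
  exact h

theorem norm_sub_jacksonMean_le {f : C(Torus q, ℂ)} (hf : MemW f) (n : ℕ) (x : Torus q) :
    ‖f x - jacksonMean n f x‖ ≤ jacksonConst / (n + 1) * Wnorm f := by
  have hc := continuous_productKernel (q := q) n
  have h1 : f x = ∫ u, f x * productKernel n u ∂torusHaar q := by
    rw [integral_const_mul, integral_complex_ofReal, integral_productKernel]
    simp
  have hI : ∀ g : Torus q → ℝ, Continuous g → Integrable g (torusHaar q) :=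
    fun g hg => integrable_of_continuous_torus hg
  conv_lhs => rw [h1, jacksonMean_apply, ← integral_sub
    (integrable_of_continuous_torus (by fun_prop)) (integrable_of_continuous_torus (by fun_prop))]
  calc _ ≤ ∫ u, ∑ j, partialSup f j * (‖u j‖ * productKernel n u) ∂torusHaar q := by
        refine norm_integral_le_of_norm_le (hI _ (by fun_prop)) (.of_forall fun u => ?_)
        rw [← sub_mul, norm_mul, norm_sub_rev, Complex.norm_real,
          Real.norm_of_nonneg (productKernel_nonneg n u)]
        refine (mul_le_mul_of_nonneg_right (norm_apply_sub_sub_le hf x u)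
          (productKernel_nonneg n u)).trans_eq ?_
        rw [sum_mul]
        exact sum_congr rfl fun j _ => by ring
    _ = ∑ j, partialSup f j * ∫ u, ‖u j‖ * productKernel n u ∂torusHaar q := by
        rw [integral_finsetSum _ fun j _ => hI _ (by fun_prop)]
        simp_rw [integral_const_mul]
    _ ≤ ∑ j, partialSup f j * (jacksonConst / (n + 1)) :=
        sum_le_sum fun j _ => mul_le_mul_of_nonneg_left (integral_norm_mul_productKernel_le n j)
          (partialSup_nonneg f j)
    _ = _ := by rw [← sum_mul, mul_comm]; rfl

theorem norm_liftT_jacksonMean_sub_le {f : C(Torus q, ℂ)} (hf : MemW f) (n : ℕ) (j : Fin q)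
    (x : Fin q → ℝ) (s : ℝ) :
    ‖liftT (jacksonMean n f) (x + s • Pi.single j 1) - liftT (jacksonMean n f) x‖ ≤
      partialSup f j * |s| := by
  have hc := continuous_productKernel (q := q) n
  simp only [liftT, jacksonMean_apply]
  rw [← integral_sub
    (integrable_of_continuous_torus (by fun_prop)) (integrable_of_continuous_torus (by fun_prop))]
  calc _ ≤ ∫ u, (partialSup f j * |s|) * productKernel n u ∂torusHaar q := by
        refine norm_integral_le_of_norm_le (integrable_of_continuous_torus (by fun_prop))
          (.of_forall fun u => ?_)
        rw [← sub_mul, norm_mul, Complex.norm_real,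
          Real.norm_of_nonneg (productKernel_nonneg n u)]
        refine mul_le_mul_of_nonneg_right ?_ (productKernel_nonneg n u)
        obtain ⟨Y, hY, -⟩ := exists_projT_eq (projT x - u)
        have h := norm_liftT_add_sub_le hf Y (s • Pi.single j 1)
        rw [sum_eq_single j (by intro i _ hi; simp [hi]) (by simp)] at h
        rw [projT_add, add_sub_right_comm, ← hY, mul_comm (partialSup f j)]
        simpa [liftT, projT_add] using h
    _ = _ := by rw [integral_const_mul, integral_productKernel, mul_one]

theorem Wnorm_jacksonMean_le {f : C(Torus q, ℂ)} (hf : MemW f) (n : ℕ) :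
    Wnorm (jacksonMean n f) ≤ Wnorm f := by
  refine sum_le_sum fun j _ => ciSup_le fun x => ?_
  change _ ≤ partialSup f j
  by_cases hd : DifferentiableAt ℝ (liftT (jacksonMean n f)) x
  · have hl : HasDerivAt (fun s : ℝ => liftT (jacksonMean n f) (x + s • Pi.single j 1)) _ 0 :=
      hd.hasFDerivAt.hasLineDerivAt (Pi.single j 1)
    refine hl.le_of_lip' (partialSup_nonneg f j) (.of_forall fun s => ?_)
    simpa using norm_liftT_jacksonMean_sub_le hf n j x s
  · rw [fderiv_zero_of_not_differentiableAt hd]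
    simpa using partialSup_nonneg f j

end JacksonMean

/-- good training error for the regularization scheme: for `f ∈ W*(𝕋^q)` and
`N ≥ B η(C)⁻¹`, any minimizer `T*(D)` of `R_N` over `H_N^q` satisfies
`max_j |y_j − T*(D)(x_j)| ≤ min_{T ∈ H_N^q} R_N(T) ≤ c { ε + (1/N) ‖f‖_{W*} }`. -/
theorem regularization_good_training_error (q : ℕ) (h : ℝ → ℝ) (hh : SmoothCutoff h)
    (S : ℕ) (hS : q < S) :
    ∃ B > 0, ∃ c > 0, ∀ (M : ℕ), 0 < M → ∀ (x : Fin M → Torus q) (f : C(Torus q, ℂ)),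
      MemW f → ∀ (y : Fin M → ℂ) (ε : ℝ), 0 ≤ ε → (∀ j, ‖y j - f (x j)‖ ≤ ε) →
      0 < minSep x → ∀ N : ℝ, B / minSep x ≤ N →
      ∀ Tstar : C(Torus q, ℂ), Tstar ∈ trigSpan q N →
      (∀ T ∈ trigSpan q N, regFunc N x y Tstar ≤ regFunc N x y T) →
      (⨆ j, ‖y j - Tstar (x j)‖) ≤ sInf {r | ∃ T ∈ trigSpan q N, r = regFunc N x y T} ∧
      sInf {r | ∃ T ∈ trigSpan q N, r = regFunc N x y T} ≤ c * (ε + (1 / N) * Wnorm f) := by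
  have hC : 0 < jacksonConst := by unfold jacksonConst; positivity
  refine ⟨1, one_pos, jacksonConst * (q + 1) + 1, by positivity, ?_⟩
  intro M hM x f hf y ε hε hy hsep N hN Tstar hT hmin
  have hN0 : 0 < N := lt_of_lt_of_le (by positivity) hN
  have hpen : ∀ T : C(Torus q, ℂ), 0 ≤ 1 / N * Wnorm T :=
    fun T => mul_nonneg (by positivity) (Wnorm_nonneg T)
  have hlow : ∀ r ∈ {r | ∃ T ∈ trigSpan q N, r = regFunc N x y T}, regFunc N x y Tstar ≤ r := by
    rintro _ ⟨T, hT', rfl⟩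
    exact hmin T hT'
  refine ⟨le_csInf ⟨_, Tstar, hT, rfl⟩ fun r hr =>
    (le_add_of_nonneg_right (hpen Tstar)).trans (hlow r hr), ?_⟩
  obtain ⟨n, hn, hn'⟩ : ∃ n : ℕ, (q : ℝ) * n < N ∧ N ≤ (q + 1) * (n + 1) := by
    have hpos : 0 < N / (q + 1) := by positivity
    obtain ⟨n, hn⟩ := Nat.exists_eq_succ_of_ne_zero (Nat.ceil_pos.2 hpos).ne'
    have h1 : (n : ℝ) < N / (q + 1) := Nat.lt_ceil.1 (by omega)
    have h2 : N / (q + 1) ≤ n + 1 := by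
      have := Nat.le_ceil (N / ((q : ℝ) + 1))
      rw [hn] at this
      exact_mod_cast this
    rw [lt_div_iff₀ (by positivity)] at h1
    rw [div_le_iff₀ (by positivity)] at h2
    have : (0 : ℝ) ≤ n := n.cast_nonneg
    exact ⟨n, by linarith, by linarith⟩
  refine (csInf_le ⟨_, hlow⟩ ⟨jacksonMean n f, jacksonMean_mem_trigSpan hn f, rfl⟩).trans ?_
  have : Nonempty (Fin M) := ⟨⟨0, hM⟩⟩
  have hW := Wnorm_nonneg f
  have hrate : jacksonConst / (n + 1) ≤ jacksonConst * (q + 1) * (1 / N) := by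
    rw [mul_one_div, div_le_div_iff₀ (by positivity) hN0, mul_assoc]
    gcongr
  have hsup : (⨆ j, ‖y j - jacksonMean n f (x j)‖) ≤
      ε + jacksonConst * (q + 1) * (1 / N) * Wnorm f :=
    ciSup_le fun j => (norm_sub_le_norm_sub_add_norm_sub _ (f (x j)) _).trans
      (add_le_add (hy j) ((norm_sub_jacksonMean_le hf n (x j)).trans (by gcongr)))
  calc regFunc N x y (jacksonMean n f)
      ≤ (ε + jacksonConst * (q + 1) * (1 / N) * Wnorm f) + 1 / N * Wnorm f :=
        add_le_add hsup (mul_le_mul_of_nonneg_left (Wnorm_jacksonMean_le hf n) (by positivity))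
    _ ≤ _ := by
        have : 0 ≤ jacksonConst * (q + 1) * ε := by positivity
        linarith
end
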